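/- Fix an irrational α with 0 < α < 1, and let f be a measurable Roman dominating function for the irrational cycle graph G_α of measured value exactly 2/3. Then the union of all connected components of G_α containing a needy vertex is a μ-null set; concretely, the set {v ∈ ℝ/ℤ : ∃ k ∈ ℤ such that v + k·α is needy under f} has μ-measure zero. -/

import Mathlib

open MeasureTheory
open scoped ENNReal

/-- If a measurable Roman dominating function for the irrational cycle graph
`G_α` has measured value exactly `2/3`, then the union of all connected
components of `G_α` containing a needy vertex is a null set. -/
theorem needy_components_null
    (α : ℝ) (hirr : Irrational α) (h0 : 0 < α) (h1 : α < 1)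
    (f : AddCircle (1:ℝ) → ℕ) (hf2 : ∀ v, f v ≤ 2)
    (hrdf : ∀ v, f v = 0 →
      f (v + (α : AddCircle (1:ℝ))) = 2 ∨ f (v - (α : AddCircle (1:ℝ))) = 2)
    (h1m : MeasurableSet (f ⁻¹' {1})) (h2m : MeasurableSet (f ⁻¹' {2}))
    (hval : 2 * volume (f ⁻¹' {2}) + volume (f ⁻¹' {1}) = 2/3) :
    volume {v : AddCircle (1:ℝ) | ∃ k : ℤ,
      f (v + (((k : ℝ) * α : ℝ) : AddCircle (1:ℝ))) = 0 ∧
      f (v + (((k : ℝ) * α : ℝ) : AddCircle (1:ℝ)) + (α : AddCircle (1:ℝ))) = 2 ∧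
      f (v + (((k : ℝ) * α : ℝ) : AddCircle (1:ℝ)) - (α : AddCircle (1:ℝ))) = 2} = 0 := by
  set a : AddCircle (1:ℝ) := (α : AddCircle (1:ℝ)) with ha
  have hP : volume ((fun v => v + a) ⁻¹' (f ⁻¹' {2})) = volume (f ⁻¹' {2}) :=
    measure_preimage_add_right volume a _
  have hQ : volume ((fun v => v + -a) ⁻¹' (f ⁻¹' {2})) = volume (f ⁻¹' {2}) :=
    measure_preimage_add_right volume (-a) _
  set P := (fun v => v + a) ⁻¹' (f ⁻¹' {2}) with hPdef
  set Q := (fun v => v + -a) ⁻¹' (f ⁻¹' {2}) with hQdef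
  have hQm : MeasurableSet Q := (measurable_add_const (-a)) h2m
  have hPQ : volume (P ∪ Q) + volume (P ∩ Q) = volume P + volume Q :=
    measure_union_add_inter P hQm
  have hcov : (1 : ℝ≥0∞) ≤ volume (f ⁻¹' {1}) + volume (f ⁻¹' {2}) + volume (P ∪ Q) := by
    have hu : volume (Set.univ : Set (AddCircle (1:ℝ))) = 1 := by
      rw [AddCircle.measure_univ]; simp
    rw [← hu]
    have hsub : (Set.univ : Set (AddCircle (1:ℝ))) ⊆ (f ⁻¹' {1} ∪ f ⁻¹' {2}) ∪ (P ∪ Q) := by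
      intro v _
      have h := hf2 v
      have h' := hrdf v
      simp only [hPdef, hQdef, Set.mem_union, Set.mem_preimage, Set.mem_singleton_iff,
        ← sub_eq_add_neg]
      by_cases hz : f v = 0
      · exact Or.inr (h' hz)
      · left; omega
    refine (measure_mono hsub).trans ((measure_union_le _ _).trans ?_)
    gcongr
    exact measure_union_le _ _
  have hI : volume (P ∩ Q) = 0 := by
    rw [hP, hQ] at hPQ
    have e1 : volume (f ⁻¹' {1}) ≠ ∞ := measure_ne_top _ _
    have e2 : volume (f ⁻¹' {2}) ≠ ∞ := measure_ne_top _ _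
    have e3 : volume (P ∪ Q) ≠ ∞ := measure_ne_top _ _
    have e4 : volume (P ∩ Q) ≠ ∞ := measure_ne_top _ _
    generalize volume (f ⁻¹' {1}) = x at *
    generalize volume (f ⁻¹' {2}) = y at *
    generalize volume (P ∪ Q) = z at *
    generalize volume (P ∩ Q) = w at *
    lift x to NNReal using e1
    lift y to NNReal using e2
    lift z to NNReal using e3
    lift w to NNReal using e4
    have k1 : (1:ℝ) ≤ x + y + z := by exact_mod_cast hcov
    have k2 : (z:ℝ) + w = y + y := by exact_mod_cast hPQ
    have k3 : 2 * (y:ℝ) + x = 2 / 3 := by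
      have := congrArg ENNReal.toReal hval
      rw [ENNReal.toReal_add (by finiteness) (by finiteness)] at this
      simpa using this
    have hx : (0:ℝ) ≤ x := x.2
    have hw : (0:ℝ) ≤ w := w.2
    have : (w:ℝ) = 0 := by linarith
    exact_mod_cast this
  have hset : {v : AddCircle (1:ℝ) | ∃ k : ℤ,
      f (v + (((k : ℝ) * α : ℝ) : AddCircle (1:ℝ))) = 0 ∧
      f (v + (((k : ℝ) * α : ℝ) : AddCircle (1:ℝ)) + a) = 2 ∧
      f (v + (((k : ℝ) * α : ℝ) : AddCircle (1:ℝ)) - a) = 2} ⊆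
      ⋃ k : ℤ, (fun v => v + (((k : ℝ) * α : ℝ) : AddCircle (1:ℝ))) ⁻¹' (P ∩ Q) := by
    rintro v ⟨k, -, hk1, hk2⟩
    refine Set.mem_iUnion.2 ⟨k, hk1, ?_⟩
    rw [sub_eq_add_neg] at hk2
    exact hk2
  refine measure_mono_null hset (measure_iUnion_null fun k => ?_)
  rw [measure_preimage_add_right]
  exact hI
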